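/- Let f : ℝ^d → ℝ be twice continuously differentiable and ρ-Hessian Lipschitz with ρ > 0, let δ > 0, and let v ∈ ℝ^d be a unit vector such that vᵀ∇²f(y)v ≤ −δ/2 at some point y. Then, with y₊ = y + (δ/ρ)·v and y₋ = y − (δ/ρ)·v, one has f(y) − (f(y₊) + f(y₋))/2 ≥ δ³/(12ρ²); in particular, choosing the sign uniformly at random, f(y) − E[f(y ± (δ/ρ)v)] ≥ δ³/(12ρ²). -/

import Mathlib

open scoped RealInnerProductSpace

/-- A function whose derivative is bounded above on `[0, ∞)` by that of `B` grows no faster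
than `B` there. -/
theorem sub_le_sub_of_hasDerivAt_le {g g' B B' : ℝ → ℝ} (hg : ∀ t, HasDerivAt g (g' t) t)
    (hB : ∀ t, HasDerivAt B (B' t) t) (hle : ∀ t, 0 ≤ t → g' t ≤ B' t) {t : ℝ} (ht : 0 ≤ t) :
    g t - g 0 ≤ B t - B 0 := by
  have hd : ∀ s, HasDerivAt (fun s => g s - B s) (g' s - B' s) s := fun s => (hg s).sub (hB s)
  have hanti : AntitoneOn (fun s => g s - B s) (Set.Ici 0) := by
    refine antitoneOn_of_deriv_nonpos (convex_Ici 0)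
      (fun s _ => (hd s).continuousAt.continuousWithinAt)
      (fun s _ => (hd s).differentiableAt.differentiableWithinAt) fun s hs => ?_
    rw [(hd s).deriv]
    rw [interior_Ici] at hs
    exact sub_nonpos.2 (hle s (le_of_lt hs))
  have h := hanti Set.self_mem_Ici ht ht
  dsimp only at h
  linarith

/-- Second-order Taylor bound for a real function whose second derivative is at most
`c + K * t` on `[0, ∞)`. -/
theorem le_taylor_of_second_deriv_le {g g' g'' : ℝ → ℝ} {c K : ℝ}
    (hg : ∀ t, HasDerivAt g (g' t) t) (hg' : ∀ t, HasDerivAt g' (g'' t) t)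
    (hle : ∀ t, 0 ≤ t → g'' t ≤ c + K * t) {t : ℝ} (ht : 0 ≤ t) :
    g t ≤ g 0 + g' 0 * t + c / 2 * t ^ 2 + K / 6 * t ^ 3 := by
  have hpow : ∀ (n : ℕ) (a s : ℝ), HasDerivAt (fun s => a * s ^ n) (a * (n * s ^ (n - 1))) s :=
    fun n a s => (hasDerivAt_pow n s).const_mul a
  have hfirst : ∀ s, 0 ≤ s → g' s ≤ g' 0 + c * s + K / 2 * s ^ 2 := by
    intro s hs
    have h := sub_le_sub_of_hasDerivAt_le (B := fun s => c * s ^ 1 + K / 2 * s ^ 2) hg'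
      (fun s => (hpow 1 c s).add (hpow 2 (K / 2) s))
      (fun s hs => (hle s hs).trans_eq (by norm_num; ring)) hs
    norm_num at h
    linarith
  have h := sub_le_sub_of_hasDerivAt_le
    (B := fun s => g' 0 * s ^ 1 + c / 2 * s ^ 2 + K / 6 * s ^ 3) hg
    (fun s => ((hpow 1 (g' 0) s).add (hpow 2 (c / 2) s)).add (hpow 3 (K / 6) s))
    (fun s hs => (hfirst s hs).trans_eq (by norm_num; ring)) ht
  norm_num at h
  linarith

section HessianLipschitz

variable {E : Type*} [NormedAddCommGroup E] [InnerProductSpace ℝ E] [CompleteSpace E]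

/-- The gradient of a twice continuously differentiable function is differentiable. -/
theorem ContDiff.differentiable_gradient {f : E → ℝ} (hf : ContDiff ℝ 2 f) :
    Differentiable ℝ (gradient f) :=
  (InnerProductSpace.toDual ℝ E).symm.toContinuousLinearEquiv.differentiable.comp
    ((hf.fderiv_right (m := 1) (by norm_num)).differentiable one_ne_zero)

/-- The cubic upper bound satisfied by a function with `ρ`-Lipschitz Hessian. -/
theorem le_taylor_of_hessian_lipschitz {f : E → ℝ} {ρ : ℝ} (hf : ContDiff ℝ 2 f)
    (hLip : ∀ x y : E, ‖fderiv ℝ (gradient f) x - fderiv ℝ (gradient f) y‖ ≤ ρ * ‖x - y‖)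
    (x w : E) :
    f (x + w) ≤ f x + ⟪gradient f x, w⟫ + ⟪w, fderiv ℝ (gradient f) x w⟫ / 2
      + ρ * ‖w‖ ^ 3 / 6 := by
  have hline : ∀ t : ℝ, HasDerivAt (fun t : ℝ => x + t • w) w t := fun t => by
    simpa using ((hasDerivAt_id t).smul_const w).const_add x
  have hg : ∀ t : ℝ, HasDerivAt (fun t : ℝ => f (x + t • w)) ⟪gradient f (x + t • w), w⟫ t :=
    fun t => by
      simpa [Function.comp_def] using (hf.differentiable two_ne_zero
        (x + t • w)).hasFDerivAt.comp_hasDerivAt t (hline t)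
  have hg' : ∀ t : ℝ, HasDerivAt (fun t : ℝ => ⟪gradient f (x + t • w), w⟫)
      ⟪fderiv ℝ (gradient f) (x + t • w) w, w⟫ t := fun t => by
    simpa using ((hf.differentiable_gradient
      (x + t • w)).hasFDerivAt.comp_hasDerivAt t (hline t)).inner ℝ (hasDerivAt_const t w)
  have hle : ∀ t : ℝ, 0 ≤ t → ⟪fderiv ℝ (gradient f) (x + t • w) w, w⟫
      ≤ ⟪w, fderiv ℝ (gradient f) x w⟫ + ρ * ‖w‖ ^ 3 * t := by
    intro t ht
    have hH := hLip (x + t • w) x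
    rw [add_sub_cancel_left, norm_smul, Real.norm_of_nonneg ht] at hH
    rw [real_inner_comm (fderiv ℝ (gradient f) x w) w, ← sub_le_iff_le_add',
      ← inner_sub_left, ← sub_apply]
    calc ⟪(fderiv ℝ (gradient f) (x + t • w) - fderiv ℝ (gradient f) x) w, w⟫
        ≤ ‖(fderiv ℝ (gradient f) (x + t • w) - fderiv ℝ (gradient f) x) w‖ * ‖w‖ :=
          real_inner_le_norm _ _
      _ ≤ ρ * (t * ‖w‖) * ‖w‖ * ‖w‖ := by
          gcongr
          exact ContinuousLinearMap.le_of_opNorm_le _ hH w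
      _ = ρ * ‖w‖ ^ 3 * t := by ring
  have h := le_taylor_of_second_deriv_le hg hg' hle zero_le_one
  simp only [one_smul, zero_smul, add_zero, one_pow, mul_one] at h
  linarith

end HessianLipschitz

/-- Negative-curvature step decrease: if `f : ℝ^d → ℝ` is twice continuously differentiable
and `ρ`-Hessian Lipschitz (`ρ > 0`), `δ > 0`, and `v` is a unit vector with
`vᵀ∇²f(y)v ≤ −δ/2`, then with `y₊ = y + (δ/ρ)v` and `y₋ = y − (δ/ρ)v`,
`f(y) − (f(y₊) + f(y₋))/2 ≥ δ³/(12ρ²)`; i.e. stepping with a uniformly random sign decreases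
`f` by at least `δ³/(12ρ²)` in expectation. -/
theorem negative_curvature_step_decrease (d : ℕ) (f : EuclideanSpace ℝ (Fin d) → ℝ) (ρ δ : ℝ)
    (hρ : 0 < ρ) (hδ : 0 < δ)
    (hf : ContDiff ℝ 2 f)
    (hHessLip : ∀ x y : EuclideanSpace ℝ (Fin d),
      ‖fderiv ℝ (gradient f) x - fderiv ℝ (gradient f) y‖ ≤ ρ * ‖x - y‖)
    (y v : EuclideanSpace ℝ (Fin d)) (hv : ‖v‖ = 1)
    (hcurv : ⟪v, fderiv ℝ (gradient f) y v⟫ ≤ -(δ / 2)) :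
    f y - (f (y + (δ / ρ) • v) + f (y - (δ / ρ) • v)) / 2 ≥ δ ^ 3 / (12 * ρ ^ 2) := by
  have hplus := le_taylor_of_hessian_lipschitz hf hHessLip y ((δ / ρ) • v)
  have hminus := le_taylor_of_hessian_lipschitz hf hHessLip y (-((δ / ρ) • v))
  have hη : 0 < δ / ρ := div_pos hδ hρ
  simp only [map_neg, map_smul, inner_neg_left, inner_neg_right, norm_neg, norm_smul,
    inner_smul_left, inner_smul_right, hv, Real.norm_of_nonneg hη.le, mul_one,
    RCLike.conj_to_real, ← sub_eq_add_neg] at hplus hminus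
  have hquad := mul_le_mul_of_nonneg_left hcurv (sq_nonneg (δ / ρ))
  have hconst : δ ^ 3 / (12 * ρ ^ 2)
      = (δ / ρ) ^ 2 * (δ / 2) / 2 - ρ * (δ / ρ) ^ 3 / 6 := by
    field_simp
    ring
  rw [hconst]
  linarith
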